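/- There is an algorithm that, given an integer k ≥ 2 and a DFAO M generating a k-automatic sequence a = (a_n)_{n≥0}, decides whether a avoids all sufficiently long palindromes, i.e., whether there exists a length l such that no factor of a of length ≥ l is a palindrome. -/

import Mathlib

/-- Run an encoded DFAO transition table from state `q` on a list of base-`k`
digits, least significant digit first (this is `w^R` for a most-significant-first
representation `w`). -/
def dfaoRun (trans : List (List ℕ)) : ℕ → List ℕ → ℕ
  | q, [] => q
  | q, d :: ds => dfaoRun trans ((trans.getD q []).getD d 0) ds

/-- The encoded DFAO `(trans, q0, out)` over input alphabet `Σ_k = {0,…,k-1}`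
generates the sequence `a`: for every `m` and every base-`k` representation `w`
of `m` (given least significant digit first, possibly with trailing zeros,
all digits `< k`), the output on `w` is `a m`. -/
def dfaoGenerates (k : ℕ) (trans : List (List ℕ)) (q0 : ℕ) (out : List ℕ)
    (a : ℕ → ℕ) : Prop :=
  ∀ (m : ℕ) (w : List ℕ), (∀ d ∈ w, d < k) → Nat.ofDigits k w = m →
    a m = out.getD (dfaoRun trans q0 w) 0

/-- The factor `a_i a_{i+1} ⋯ a_{i+L-1}` of the sequence `a`. -/
def factorAt (a : ℕ → ℕ) (i L : ℕ) : List ℕ :=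
  (List.range L).map fun j => a (i + j)

/-- `w` is a factor of the infinite word `a`. -/
def IsFactorOf (a : ℕ → ℕ) (w : List ℕ) : Prop :=
  ∃ i : ℕ, w = factorAt a i w.length

/-- The length-`L` window of `a` starting at `i` is symmetric about its centre. -/
def IsPalAt (a : ℕ → ℕ) (i L : ℕ) : Prop :=
  ∀ u v : ℕ, u + v + 1 = 2 * i + L → i ≤ u → i ≤ v → a u = a v

theorem isPalAt_iff_forall_lt {a : ℕ → ℕ} {i L : ℕ} :
    IsPalAt a i L ↔ ∀ j < L, a (i + j) = a (i + (L - 1 - j)) := by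
  constructor
  · intro h j hj
    exact h _ _ (by omega) (by omega) (by omega)
  · intro h u v huv hu hv
    have := h (u - i) (by omega)
    rwa [show i + (u - i) = u by omega, show i + (L - 1 - (u - i)) = v by omega] at this

theorem factorAt_reverse_eq_iff {a : ℕ → ℕ} {i L : ℕ} :
    (factorAt a i L).reverse = factorAt a i L ↔ IsPalAt a i L := by
  rw [isPalAt_iff_forall_lt]
  constructor
  · intro h j hj
    have := congrArg (fun l => l[j]?) h
    simp [factorAt, hj] at this
    rw [← this]
  · intro h
    apply List.ext_getElem
    · simp
    · intro j h1 h2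
      have hj : j < L := by simpa [factorAt] using h2
      simpa [factorAt] using (h j hj).symm

theorem avoids_iff_isPalAt {a : ℕ → ℕ} :
    (∃ l : ℕ, ∀ w : List ℕ, IsFactorOf a w → l ≤ w.length → w.reverse ≠ w) ↔
      ∃ l : ℕ, ∀ i L : ℕ, l ≤ L → ¬ IsPalAt a i L := by
  refine exists_congr fun l => ⟨fun h i L hL hp => ?_, fun h w hw hl hr => ?_⟩
  · exact h (factorAt a i L) ⟨i, by simp [factorAt]⟩ (by simpa [factorAt] using hL)
      (factorAt_reverse_eq_iff.2 hp)
  · obtain ⟨i, hi⟩ := hw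
    exact h i _ hl (factorAt_reverse_eq_iff.1 (by rw [← hi, hr]))

theorem IsPalAt.shrink {a : ℕ → ℕ} {i L : ℕ} (h : IsPalAt a i (L + 2)) : IsPalAt a (i + 1) L :=
  fun u v huv hu hv => h u v (by omega) (by omega) (by omega)

theorem IsPalAt.exists_short {a : ℕ → ℕ} {B : ℕ} :
    ∀ {L i : ℕ}, B ≤ L → IsPalAt a i L → ∃ c < 2, ∃ i', IsPalAt a i' (B + c) := by
  intro L
  induction L using Nat.strong_induction_on with
  | _ L ih =>
    intro i hL h
    rcases Nat.lt_or_ge L (B + 2) with hlt | hge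
    · exact ⟨L - B, by omega, i, by rwa [show B + (L - B) = L by omega]⟩
    · obtain ⟨M, rfl⟩ : ∃ M, L = M + 2 := ⟨L - 2, by omega⟩
      exact ih M (by omega) (by omega) h.shrink

section Kernel

variable {Q : Type*}

/-- The finite information about `i, L < k ^ e` that determines for which `i₁, L₁` the window of
length `L + k ^ e * L₁` at `i + k ^ e * i₁` is a palindrome. -/
def palType (k : ℕ) (s : ℕ → ℕ → Q) (e i L : ℕ) : Set (Q × Q × Fin 4 × Bool × Bool) :=
  {x | ∃ u < k ^ e, ∃ v < k ^ e, x.1 = s e u ∧ x.2.1 = s e v ∧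
    u + v + 1 + k ^ e * (x.2.2.1 : ℕ) = 2 * i + L + k ^ e ∧
    x.2.2.2.1 = decide (u < i) ∧ x.2.2.2.2 = decide (v < i)}

theorem add_mul_le_add_mul_iff {K u i u₁ i₁ : ℕ} (hu : u < K) (hi : i < K) :
    i + K * i₁ ≤ u + K * u₁ ↔ i₁ + (decide (u < i)).toNat ≤ u₁ := by
  have key : ∀ x y : ℕ, x < y → K * x + K ≤ K * y := fun x y h => by
    have := Nat.mul_le_mul_left K (Nat.succ_le_of_lt h)
    rwa [Nat.mul_succ] at this
  rcases lt_trichotomy u₁ i₁ with h | h | h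
  · have := key _ _ h
    by_cases hc : u < i <;> simp [hc] <;> omega
  · subst h
    by_cases hc : u < i <;> simp [hc]; omega
  · have := key _ _ h
    by_cases hc : u < i <;> simp [hc] <;> omega

variable {k : ℕ} {s : ℕ → ℕ → Q} {F : Q → ℕ → ℕ} {a : ℕ → ℕ}

theorem isPalAt_iff_palType (hk : 2 ≤ k)
    (H : ∀ e r m, r < k ^ e → a (r + k ^ e * m) = F (s e r) m)
    {e i L : ℕ} (hi : i < k ^ e) (hL : L < k ^ e) (i₁ L₁ : ℕ) :
    IsPalAt a (i + k ^ e * i₁) (L + k ^ e * L₁) ↔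
      ∀ x ∈ palType k s e i L, ∀ u v : ℕ, u + v + 1 = 2 * i₁ + L₁ + (x.2.2.1 : ℕ) →
        i₁ + x.2.2.2.1.toNat ≤ u → i₁ + x.2.2.2.2.toNat ≤ v → F x.1 u = F x.2.1 v := by
  have hK : 0 < k ^ e := by positivity
  unfold palType
  generalize hKe : k ^ e = K at *
  constructor
  · rintro h ⟨p, q, t, b, c⟩ ⟨u, hu, v, hv, rfl, rfl, ht, rfl, rfl⟩ u₁ v₁ h1 h2 h3
    have Hu := H e u u₁ (hKe ▸ hu)
    have Hv := H e v v₁ (hKe ▸ hv)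
    rw [hKe] at Hu Hv
    dsimp only at *
    rw [← Hu, ← Hv]
    refine h _ _ ?_ ((add_mul_le_add_mul_iff hu hi).2 h2) ((add_mul_le_add_mul_iff hv hi).2 h3)
    zify at h1 ht ⊢
    linear_combination (K : ℤ) * h1 + ht
  · intro h u v huv hu hv
    have hu' := Nat.mod_add_div u K
    have hv' := Nat.mod_add_div v K
    have hum := Nat.mod_lt u hK
    have hvm := Nat.mod_lt v hK
    generalize u % K = u₀ at *
    generalize u / K = u₁ at *
    generalize v % K = v₀ at *
    generalize v / K = v₁ at *
    subst hu' hv'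
    have hlo : 2 * i₁ + L₁ ≤ u₁ + v₁ + 1 := by
      by_contra hc
      nlinarith [Nat.mul_le_mul_left K (show u₁ + v₁ + 2 ≤ 2 * i₁ + L₁ by omega)]
    have hhi : u₁ + v₁ + 1 < 2 * i₁ + L₁ + 4 := by
      by_contra hc
      nlinarith [Nat.mul_le_mul_left K (show 2 * i₁ + L₁ + 4 ≤ u₁ + v₁ + 1 by omega)]
    obtain ⟨t, ht⟩ := Nat.exists_eq_add_of_le hlo
    have Hu := H e u₀ u₁ (hKe ▸ hum)
    have Hv := H e v₀ v₁ (hKe ▸ hvm)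
    rw [hKe] at Hu Hv
    rw [Hu, Hv]
    refine h (s e u₀, s e v₀, ⟨t, by omega⟩, decide (u₀ < i), decide (v₀ < i))
      ⟨u₀, hum, v₀, hvm, rfl, rfl, ?_, rfl, rfl⟩ u₁ v₁ ht
      ((add_mul_le_add_mul_iff hum hi).1 hu) ((add_mul_le_add_mul_iff hvm hi).1 hv)
    dsimp only
    zify at ht huv ⊢
    linear_combination huv - (K : ℤ) * ht

theorem isPalAt_congr (hk : 2 ≤ k)
    (H : ∀ e r m, r < k ^ e → a (r + k ^ e * m) = F (s e r) m)
    {e e' i L i' L' : ℕ} (hi : i < k ^ e) (hL : L < k ^ e) (hi' : i' < k ^ e') (hL' : L' < k ^ e')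
    (hT : palType k s e i L = palType k s e' i' L') (i₁ L₁ : ℕ) :
    IsPalAt a (i + k ^ e * i₁) (L + k ^ e * L₁) ↔
      IsPalAt a (i' + k ^ e' * i₁) (L' + k ^ e' * L₁) := by
  rw [isPalAt_iff_palType hk H hi hL, isPalAt_iff_palType hk H hi' hL', hT]

theorem exists_palType_eq [Fintype Q] (k : ℕ) (s : ℕ → ℕ → Q) {N : ℕ}
    (hN : 2 ^ (Fintype.card Q * (Fintype.card Q * 16)) ≤ N) (e₀ i L : ℕ) :
    ∃ e e', e₀ ≤ e ∧ e < e' ∧ e' ≤ e₀ + N ∧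
      palType k s e (i % k ^ e) (L % k ^ e) = palType k s e' (i % k ^ e') (L % k ^ e') := by
  classical
  obtain ⟨x, y, hne, hxy⟩ := Fintype.exists_ne_map_eq_of_card_lt
    (fun e : Fin (N + 1) => palType k s (e₀ + e) (i % k ^ (e₀ + e : ℕ)) (L % k ^ (e₀ + e : ℕ)))
    (by simpa [Fintype.card_set] using Nat.lt_succ_of_le hN)
  rcases lt_or_gt_of_ne (Fin.val_ne_of_ne hne) with h | h
  · exact ⟨e₀ + x, e₀ + y, by omega, by omega, by omega, hxy⟩
  · exact ⟨e₀ + y, e₀ + x, by omega, by omega, by omega, hxy.symm⟩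

theorem add_pow_mul_lt_add_pow_mul (hk : 2 ≤ k) {e e' x y m : ℕ} (he : e < e') (hx : x < k ^ e)
    (hm : 0 < m) : x + k ^ e * m < y + k ^ e' * m := by
  have h1 : k ^ e * 2 ≤ k ^ e' := calc
    k ^ e * 2 ≤ k ^ e * k := Nat.mul_le_mul_left _ hk
    _ = k ^ (e + 1) := (pow_succ _ _).symm
    _ ≤ k ^ e' := Nat.pow_le_pow_right (by omega) he
  nlinarith [Nat.mul_le_mul_right m h1, Nat.mul_le_mul_left (k ^ e) (Nat.succ_le_of_lt hm)]

theorem IsPalAt.exists_longer [Fintype Q] (hk : 2 ≤ k)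
    (H : ∀ e r m, r < k ^ e → a (r + k ^ e * m) = F (s e r) m) {N : ℕ}
    (hN : 2 ^ (Fintype.card Q * (Fintype.card Q * 16)) ≤ N) {i L : ℕ} (hL : k ^ N ≤ L)
    (h : IsPalAt a i L) : ∃ i' L', L < L' ∧ IsPalAt a i' L' := by
  obtain ⟨e, e', -, hlt, hle, hT⟩ := exists_palType_eq k s hN 0 i L
  have hm : ∀ x e, x % k ^ e < k ^ e := fun x e => Nat.mod_lt _ (by positivity)
  have hc := isPalAt_congr hk H (hm i e) (hm L e) (hm i e') (hm L e') hT (i / k ^ e) (L / k ^ e)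
  rw [Nat.mod_add_div, Nat.mod_add_div] at hc
  refine ⟨_, _, ?_, hc.1 h⟩
  have hpos : 0 < L / k ^ e :=
    Nat.div_pos ((Nat.pow_le_pow_right (by omega) (by omega)).trans hL) (by positivity)
  have := add_pow_mul_lt_add_pow_mul (y := L % k ^ e') hk hlt (hm L e) hpos
  rwa [Nat.mod_add_div] at this

theorem IsPalAt.exists_start_lt [Fintype Q] (hk : 2 ≤ k)
    (H : ∀ e r m, r < k ^ e → a (r + k ^ e * m) = F (s e r) m) {N : ℕ}
    (hN : 2 ^ (Fintype.card Q * (Fintype.card Q * 16)) ≤ N) {L M : ℕ} (hL : L < k ^ M) :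
    ∀ {i : ℕ}, IsPalAt a i L → ∃ i' < k ^ (M + N), IsPalAt a i' L := by
  intro i
  induction i using Nat.strong_induction_on with
  | _ i ih =>
    intro h
    rcases Nat.lt_or_ge i (k ^ (M + N)) with hlt | hge
    · exact ⟨i, hlt, h⟩
    obtain ⟨e, e', hMe, hlt, hle, hT⟩ := exists_palType_eq k s hN M i L
    have hm : ∀ e, i % k ^ e < k ^ e := fun e => Nat.mod_lt _ (by positivity)
    have hLe : L < k ^ e := hL.trans_le (Nat.pow_le_pow_right (by omega) hMe)
    have hLe' : L < k ^ e' := hL.trans_le (Nat.pow_le_pow_right (by omega) (by omega))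
    rw [Nat.mod_eq_of_lt hLe, Nat.mod_eq_of_lt hLe'] at hT
    have hc := isPalAt_congr hk H (hm e) hLe (hm e') hLe' hT (i / k ^ e') 0
    rw [Nat.mod_add_div, mul_zero, mul_zero, add_zero] at hc
    have hpos : 0 < i / k ^ e' :=
      Nat.div_pos ((Nat.pow_le_pow_right (by omega) hle).trans hge) (by positivity)
    have := add_pow_mul_lt_add_pow_mul (y := i % k ^ e') hk hlt (hm e) hpos
    rw [Nat.mod_add_div] at this
    exact ih _ this (hc.2 h)

theorem avoids_iff_bounded [Fintype Q] (hk : 2 ≤ k)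
    (H : ∀ e r m, r < k ^ e → a (r + k ^ e * m) = F (s e r) m) {N : ℕ}
    (hN : 2 ^ (Fintype.card Q * (Fintype.card Q * 16)) ≤ N) :
    (∃ l : ℕ, ∀ i L : ℕ, l ≤ L → ¬ IsPalAt a i L) ↔
      ¬ ∃ c < 2, ∃ i < k ^ (N + 1 + N), IsPalAt a i (k ^ N + c) := by
  constructor
  · rintro ⟨l, hl⟩ ⟨c, -, i, -, h⟩
    have grow : ∀ m, ∃ i L, k ^ N + m ≤ L ∧ IsPalAt a i L := by
      intro m
      induction m with
      | zero => exact ⟨i, _, by omega, h⟩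
      | succ m ih =>
        obtain ⟨i, L, hL, hp⟩ := ih
        obtain ⟨i', L', hL', hp'⟩ := hp.exists_longer hk H hN (by omega)
        exact ⟨i', L', by omega, hp'⟩
    obtain ⟨i, L, hL, hp⟩ := grow l
    exact hl i L (by omega) hp
  · intro h
    refine ⟨k ^ N, fun i L hL hp => h ?_⟩
    obtain ⟨c, hc, i', hp'⟩ := hp.exists_short hL
    refine ⟨c, hc, hp'.exists_start_lt hk H hN ?_⟩
    have h1 : 2 ≤ k ^ N :=
      hk.trans (Nat.le_self_pow (Nat.one_le_iff_ne_zero.1 (Nat.one_le_two_pow.trans hN)) k)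
    rw [pow_succ]
    nlinarith

end Kernel

/-- The `e` least significant base-`k` digits of `r`, least significant first. -/
def lowDigits (k : ℕ) : ℕ → ℕ → List ℕ
  | 0, _ => []
  | e + 1, r => r % k :: lowDigits k e (r / k)

theorem lt_of_mem_lowDigits {k : ℕ} (hk : 0 < k) :
    ∀ {e r d : ℕ}, d ∈ lowDigits k e r → d < k
  | 0, _, _, h => by simp [lowDigits] at h
  | e + 1, r, d, h => by
    rcases List.mem_cons.1 h with rfl | h
    · exact Nat.mod_lt _ hk
    · exact lt_of_mem_lowDigits hk h

theorem length_lowDigits (k : ℕ) : ∀ e r : ℕ, (lowDigits k e r).length = e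
  | 0, _ => rfl
  | e + 1, r => by simp [lowDigits, length_lowDigits k e]

theorem ofDigits_lowDigits (k : ℕ) :
    ∀ {e r : ℕ}, r < k ^ e → Nat.ofDigits k (lowDigits k e r) = r
  | 0, r, h => by simp at h; simp [lowDigits, h]
  | e + 1, r, h => by
    have : r / k < k ^ e := Nat.div_lt_of_lt_mul (by rwa [pow_succ'] at h)
    rw [lowDigits, Nat.ofDigits_cons, ofDigits_lowDigits k this]
    simp [Nat.mod_add_div]

theorem dfaoRun_append (trans : List (List ℕ)) :
    ∀ (w w' : List ℕ) (q : ℕ), dfaoRun trans q (w ++ w') = dfaoRun trans (dfaoRun trans q w) w'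
  | [], _, _ => rfl
  | _ :: w, w', _ => dfaoRun_append trans w w' _

theorem Encodable.encode_le_encode_of_mem {α : Type*} [Encodable α] {x : α} :
    ∀ {l : List α}, x ∈ l → Encodable.encode x ≤ Encodable.encode l
  | y :: l, h => by
    rw [Encodable.encode_list_cons]
    rcases List.mem_cons.1 h with rfl | h
    · exact (Nat.left_le_pair _ _).trans (Nat.le_succ _)
    · exact (encode_le_encode_of_mem h).trans ((Nat.right_le_pair _ _).trans (Nat.le_succ _))

theorem getD_getD_le_encode (trans : List (List ℕ)) (q d : ℕ) :
    (trans.getD q []).getD d 0 ≤ Encodable.encode trans := by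
  rcases Nat.lt_or_ge q trans.length with hq | hq
  · rw [List.getD_eq_getElem _ _ hq]
    rcases Nat.lt_or_ge d trans[q].length with hd | hd
    · rw [List.getD_eq_getElem _ _ hd]
      exact (Encodable.encode_le_encode_of_mem (List.getElem_mem hd)).trans
        (Encodable.encode_le_encode_of_mem (List.getElem_mem hq))
    · rw [List.getD_eq_default _ _ hd]
      exact Nat.zero_le _
  · rw [List.getD_eq_default _ _ hq]
    simp

theorem dfaoRun_lt {trans : List (List ℕ)} {n : ℕ} (hn : Encodable.encode trans < n) :
    ∀ (w : List ℕ) {q : ℕ}, q < n → dfaoRun trans q w < n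
  | [], _, hq => hq
  | d :: w, q, _ => dfaoRun_lt hn w ((getD_getD_le_encode trans q d).trans_lt hn)

/-- One step of reading the low digit of `x.2` from state `x.1`. -/
def dfaoStep (k : ℕ) (trans : List (List ℕ)) (x : ℕ × ℕ) : ℕ × ℕ :=
  ((trans.getD x.1 []).getD (x.2 % k) 0, x.2 / k)

theorem iterate_dfaoStep (k : ℕ) (trans : List (List ℕ)) :
    ∀ e q r : ℕ, ((dfaoStep k trans)^[e] (q, r)).1 = dfaoRun trans q (lowDigits k e r)
  | 0, _, _ => rfl
  | e + 1, _, _ => iterate_dfaoStep k trans e _ _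

/-- The `m`-th term of the sequence computed by an encoded DFAO. -/
def dfaoTerm (p : ℕ × List (List ℕ) × ℕ × List ℕ) (m : ℕ) : ℕ :=
  p.2.2.2.getD ((dfaoStep p.1 p.2.1)^[m] (p.2.2.1, m)).1 0

theorem dfaoGenerates.eq_dfaoTerm {k : ℕ} {trans : List (List ℕ)} {q0 : ℕ} {out : List ℕ}
    {a : ℕ → ℕ} (hk : 2 ≤ k) (h : dfaoGenerates k trans q0 out a) :
    a = dfaoTerm (k, trans, q0, out) := by
  funext m
  rw [dfaoTerm, iterate_dfaoStep]
  exact h m _ (fun d => lt_of_mem_lowDigits (by omega))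
    (ofDigits_lowDigits k (Nat.lt_pow_self (by omega)))

theorem dfaoGenerates.kernel {k : ℕ} {trans : List (List ℕ)} {q0 : ℕ} {out : List ℕ}
    {a : ℕ → ℕ} (hk : 2 ≤ k) (h : dfaoGenerates k trans q0 out a) (e r m : ℕ) (hr : r < k ^ e) :
    a (r + k ^ e * m) =
      out.getD (dfaoRun trans (dfaoRun trans q0 (lowDigits k e r)) (lowDigits k m m)) 0 := by
  rw [← dfaoRun_append]
  refine h _ _ (fun d hd => ?_) ?_
  · rcases List.mem_append.1 hd with hd | hd <;> exact lt_of_mem_lowDigits (by omega) hd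
  · rw [Nat.ofDigits_append, length_lowDigits, ofDigits_lowDigits k hr,
      ofDigits_lowDigits k (Nat.lt_pow_self (by omega))]

/-- A strict upper bound for the states reachable in an encoded DFAO. -/
def stateBound (p : ℕ × List (List ℕ) × ℕ × List ℕ) : ℕ :=
  Encodable.encode p.2.1 + p.2.2.1 + 1

/-- A number of digits sufficient for pumping palindromes of an encoded DFAO. -/
def pumpBound (p : ℕ × List (List ℕ) × ℕ × List ℕ) : ℕ :=
  2 ^ (stateBound p * (stateBound p * 16))

/-- The finite search deciding whether arbitrarily long palindromes occur. -/
def HasBoundedPal (p : ℕ × List (List ℕ) × ℕ × List ℕ) : Prop :=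
  ∃ c < 2, ∃ i < p.1 ^ (pumpBound p + 1 + pumpBound p), ∀ j < p.1 ^ pumpBound p + c,
    dfaoTerm p (i + j) = dfaoTerm p (i + (p.1 ^ pumpBound p + c - 1 - j))

theorem PrimrecRel.forall_lt_bound {α : Type*} [Primcodable α] {R : ℕ → α → Prop}
    (hR : PrimrecRel R) {g : α → ℕ} (hg : Primrec g) : PrimrecPred fun y => ∀ x < g y, R x y :=
  (hR.forall_mem_list.comp (Primrec.list_range.comp hg) Primrec.id).of_eq (by simp)

theorem PrimrecRel.exists_lt_bound {α : Type*} [Primcodable α] {R : ℕ → α → Prop}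
    (hR : PrimrecRel R) {g : α → ℕ} (hg : Primrec g) : PrimrecPred fun y => ∃ x < g y, R x y :=
  (hR.exists_mem_list.comp (Primrec.list_range.comp hg) Primrec.id).of_eq (by simp)

theorem primrec_nat_pow : Primrec₂ ((· ^ ·) : ℕ → ℕ → ℕ) :=
  Primrec₂.unpaired'.1 Nat.Primrec.pow

theorem primrec_dfaoTerm : Primrec₂ dfaoTerm := by
  have hstep : Primrec₂ fun (x : (ℕ × List (List ℕ) × ℕ × List ℕ) × ℕ) (y : ℕ × ℕ) =>
      dfaoStep x.1.1 x.1.2.1 y := by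
    have hp : Primrec fun z : ((ℕ × List (List ℕ) × ℕ × List ℕ) × ℕ) × (ℕ × ℕ) => z.1.1 :=
      Primrec.fst.comp Primrec.fst
    have hx : Primrec fun z : ((ℕ × List (List ℕ) × ℕ × List ℕ) × ℕ) × (ℕ × ℕ) => z.2.1 :=
      Primrec.fst.comp Primrec.snd
    have hy : Primrec fun z : ((ℕ × List (List ℕ) × ℕ × List ℕ) × ℕ) × (ℕ × ℕ) => z.2.2 :=
      Primrec.snd.comp Primrec.snd
    have hk := Primrec.fst.comp hp
    exact ((Primrec.list_getD 0).comp
      ((Primrec.list_getD []).comp (Primrec.fst.comp (Primrec.snd.comp hp)) hx)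
      (Primrec.nat_mod.comp hy hk)).pair (Primrec.nat_div.comp hy hk)
  have hq : Primrec fun x : (ℕ × List (List ℕ) × ℕ × List ℕ) × ℕ => x.1.2.2 :=
    Primrec.snd.comp (Primrec.snd.comp Primrec.fst)
  exact (Primrec.list_getD 0).comp (Primrec.snd.comp hq)
    (Primrec.fst.comp (Primrec.nat_iterate Primrec.snd
      ((Primrec.fst.comp hq).pair Primrec.snd) hstep))

theorem primrec_pumpBound : Primrec pumpBound := by
  have hs : Primrec stateBound :=
    Primrec.succ.comp (Primrec.nat_add.comp
      (Primrec.encode.comp (Primrec.fst.comp Primrec.snd))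
      (Primrec.fst.comp (Primrec.snd.comp Primrec.snd)))
  exact primrec_nat_pow.comp (Primrec.const 2)
    (Primrec.nat_mul.comp hs (Primrec.nat_mul.comp hs (Primrec.const 16)))

theorem primrecPred_hasBoundedPal : PrimrecPred HasBoundedPal := by
  have hlen : Primrec₂ fun (p : ℕ × List (List ℕ) × ℕ × List ℕ) (c : ℕ) =>
      p.1 ^ pumpBound p + c :=
    Primrec.nat_add.comp (primrec_nat_pow.comp (Primrec.fst.comp Primrec.fst)
      (primrec_pumpBound.comp Primrec.fst)) Primrec.snd
  have heq : PrimrecRel fun (j : ℕ) (y : ℕ × ℕ × (ℕ × List (List ℕ) × ℕ × List ℕ)) =>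
      dfaoTerm y.2.2 (y.1 + j) =
        dfaoTerm y.2.2 (y.1 + (y.2.2.1 ^ pumpBound y.2.2 + y.2.1 - 1 - j)) := by
    have hi : Primrec fun z : ℕ × ℕ × ℕ × (ℕ × List (List ℕ) × ℕ × List ℕ) => z.2.1 :=
      Primrec.fst.comp Primrec.snd
    have hc : Primrec fun z : ℕ × ℕ × ℕ × (ℕ × List (List ℕ) × ℕ × List ℕ) => z.2.2.1 :=
      Primrec.fst.comp (Primrec.snd.comp Primrec.snd)
    have hp : Primrec fun z : ℕ × ℕ × ℕ × (ℕ × List (List ℕ) × ℕ × List ℕ) => z.2.2.2 :=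
      Primrec.snd.comp (Primrec.snd.comp Primrec.snd)
    exact Primrec.eq.comp (primrec_dfaoTerm.comp hp (Primrec.nat_add.comp hi Primrec.fst))
      (primrec_dfaoTerm.comp hp (Primrec.nat_add.comp hi (Primrec.nat_sub.comp
        (Primrec.nat_sub.comp (hlen.comp hp hc) (Primrec.const 1)) Primrec.fst)))
  have hall : PrimrecRel fun (i : ℕ) (y : ℕ × (ℕ × List (List ℕ) × ℕ × List ℕ)) =>
      ∀ j < y.2.1 ^ pumpBound y.2 + y.1, dfaoTerm y.2 (i + j) =
        dfaoTerm y.2 (i + (y.2.1 ^ pumpBound y.2 + y.1 - 1 - j)) :=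
    heq.forall_lt_bound
      (hlen.comp (Primrec.snd.comp Primrec.snd) (Primrec.fst.comp Primrec.snd))
  have hstart : PrimrecRel fun (c : ℕ) (p : ℕ × List (List ℕ) × ℕ × List ℕ) =>
      ∃ i < p.1 ^ (pumpBound p + 1 + pumpBound p), ∀ j < p.1 ^ pumpBound p + c,
        dfaoTerm p (i + j) = dfaoTerm p (i + (p.1 ^ pumpBound p + c - 1 - j)) := by
    have hN : Primrec fun z : ℕ × (ℕ × List (List ℕ) × ℕ × List ℕ) => pumpBound z.2 :=
      primrec_pumpBound.comp Primrec.snd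
    exact hall.exists_lt_bound (primrec_nat_pow.comp (Primrec.fst.comp Primrec.snd)
      (Primrec.nat_add.comp (Primrec.succ.comp hN) hN))
  exact hstart.exists_lt_bound (Primrec.const 2)

/-- It is decidable, given `k ≥ 2` and a DFAO generating a `k`-automatic
sequence `a`, whether `a` avoids all sufficiently long palindromes, i.e.
whether there is a length `l` such that no factor of `a` of length `≥ l` is a
palindrome. -/
theorem avoidsPalindromesEventually_decidable :
    ∃ f : ℕ × List (List ℕ) × ℕ × List ℕ → Bool,
      Computable f ∧
      ∀ (k : ℕ) (trans : List (List ℕ)) (q0 : ℕ) (out : List ℕ) (a : ℕ → ℕ),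
        2 ≤ k → dfaoGenerates k trans q0 out a →
        (f (k, trans, q0, out) = true ↔
          ∃ l : ℕ, ∀ w : List ℕ, IsFactorOf a w → l ≤ w.length →
            w.reverse ≠ w) := by
  obtain ⟨_, hdec⟩ := primrecPred_hasBoundedPal.not
  refine ⟨fun p => decide (¬ HasBoundedPal p), hdec.to_comp, ?_⟩
  intro k trans q0 out a hk h
  set p : ℕ × List (List ℕ) × ℕ × List ℕ := (k, trans, q0, out)
  have hrun : ∀ w, dfaoRun trans q0 w < stateBound p := fun w =>
    dfaoRun_lt (by simp only [stateBound, p]; omega) w (by simp only [stateBound, p]; omega)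
  rw [avoids_iff_isPalAt, avoids_iff_bounded (Q := Fin (stateBound p)) (N := pumpBound p)
    (s := fun e r => ⟨_, hrun (lowDigits k e r)⟩)
    (F := fun q m => out.getD (dfaoRun trans q (lowDigits k m m)) 0) hk (h.kernel hk)
    (by rw [Fintype.card_fin, pumpBound]), decide_eq_true_iff]
  simp only [HasBoundedPal, isPalAt_iff_forall_lt, h.eq_dfaoTerm hk, p]
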